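/- arXiv:0811.1667 — 2 statements merged into one kernel-verified Lean document; each statement's English description precedes it below -/
import Mathlib

section
/- Let σ ∈ [0,1], let E be a finite-dimensional normed vector space, let f ∈ G_σ(ℝ^p, E) (respectively f ∈ S_σ(ℝ^p)) and let g ∈ G_σ(ℝ^n, ℝ^p) be such that, in case σ > 0, there exists ε > 0 with ⟨g(v)⟩ ≥ ε⟨v⟩ for all v ∈ ℝ^n. Then f ∘ g ∈ G_σ(ℝ^n, E) (respectively f ∘ g ∈ S_σ(ℝ^n)). -/
open MeasureTheory
open scoped BigOperators

noncomputable section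

/-- Japanese bracket `⟨v⟩ = (1 + ‖v‖²)^(1/2)` (with the Euclidean norm). -/
def jb {n : ℕ} (v : Fin n → ℝ) : ℝ := Real.sqrt (1 + ∑ i, (v i) ^ 2)

/-- Japanese bracket of a pair of vectors, `⟨(x,y)⟩`. -/
def jb2 {n m : ℕ} (x : Fin n → ℝ) (y : Fin m → ℝ) : ℝ :=
  Real.sqrt (1 + ∑ i, (x i) ^ 2 + ∑ j, (y j) ^ 2)

/-- Euclidean inner product `⟨ϑ, ζ⟩`. -/
def ip {n : ℕ} (ϑ ζ : Fin n → ℝ) : ℝ := ∑ i, ϑ i * ζ i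

/-- Partial derivative in the `i`-th coordinate direction. -/
def pd {n : ℕ} {E : Type*} [NormedAddCommGroup E] [NormedSpace ℝ E]
    (i : Fin n) (f : (Fin n → ℝ) → E) : (Fin n → ℝ) → E :=
  fun x => fderiv ℝ f x (Pi.single i 1)

/-- Iterated partial derivative `∂^ν` along the multi-index `ν`. -/
def pdm {n : ℕ} {E : Type*} [NormedAddCommGroup E] [NormedSpace ℝ E]
    (ν : Fin n → ℕ) (f : (Fin n → ℝ) → E) : (Fin n → ℝ) → E :=
  (List.finRange n).foldr (fun i g => (pd i)^[ν i] g) f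

/-- Mixed partial derivative `∂_x^α ∂_y^β` of a function of two vector variables. -/
def pdm2 {n m : ℕ} {E : Type*} [NormedAddCommGroup E] [NormedSpace ℝ E]
    (α : Fin n → ℕ) (β : Fin m → ℕ) (f : (Fin n → ℝ) → (Fin m → ℝ) → E) :
    (Fin n → ℝ) → (Fin m → ℝ) → E :=
  fun x y => pdm α (fun x' => pdm β (f x') y) x

/-- Mixed partial derivative `∂_x^α ∂_y^β ∂_z^γ` of a function of three vector variables. -/
def pdm3 {n m k : ℕ} {E : Type*} [NormedAddCommGroup E] [NormedSpace ℝ E]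
    (α : Fin n → ℕ) (β : Fin m → ℕ) (γ : Fin k → ℕ)
    (f : (Fin n → ℝ) → (Fin m → ℝ) → (Fin k → ℝ) → E) :
    (Fin n → ℝ) → (Fin m → ℝ) → (Fin k → ℝ) → E :=
  fun x y z => pdm α (fun x' => pdm β (fun y' => pdm γ (f x' y') z) y) x

/-- Length `|ν|` of a multi-index. -/
def msize {n : ℕ} (ν : Fin n → ℕ) : ℕ := ∑ i, ν i

/-- The class `G_σ(ℝ^n, E)`: smooth functions whose `ν`-th derivative is
`O(⟨v⟩^{-σ(|ν|-1)})` for every `ν ≠ 0`. -/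
def GsigmaCl {n : ℕ} {E : Type*} [NormedAddCommGroup E] [NormedSpace ℝ E]
    (σ : ℝ) (f : (Fin n → ℝ) → E) : Prop :=
  ContDiff ℝ (⊤ : ℕ∞) f ∧ ∀ ν : Fin n → ℕ, ν ≠ 0 → ∃ C > 0, ∀ v,
    ‖pdm ν f v‖ ≤ C * jb v ^ (-(σ * ((msize ν : ℝ) - 1)))

/-- The class `S_σ(ℝ^n)`: smooth real functions whose `ν`-th derivative is
`O(⟨v⟩^{-σ|ν|})` for every `ν`. -/
def SsigmaCl {n : ℕ} (σ : ℝ) (f : (Fin n → ℝ) → ℝ) : Prop :=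
  ContDiff ℝ (⊤ : ℕ∞) f ∧ ∀ ν : Fin n → ℕ, ∃ C > 0, ∀ v,
    |pdm ν f v| ≤ C * jb v ^ (-(σ * (msize ν : ℝ)))

/-- `G_σ^×(ℝ^p)`: diffeomorphisms `g` of `ℝ^p` with `g` and `g⁻¹` in `G_σ`. -/
def GsigmaX {p : ℕ} (σ : ℝ) (g : (Fin p → ℝ) → (Fin p → ℝ)) : Prop :=
  ∃ h : (Fin p → ℝ) → (Fin p → ℝ),
    Function.LeftInverse h g ∧ Function.RightInverse h g ∧ GsigmaCl σ g ∧ GsigmaCl σ h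

/-- The class `O_M(ℝ^n, E)`: smooth functions with polynomially bounded derivatives. -/
def OMCl {n : ℕ} {E : Type*} [NormedAddCommGroup E] [NormedSpace ℝ E]
    (f : (Fin n → ℝ) → E) : Prop :=
  ContDiff ℝ (⊤ : ℕ∞) f ∧ ∀ ν : Fin n → ℕ, ∃ C > 0, ∃ k : ℕ, ∀ v,
    ‖pdm ν f v‖ ≤ C * jb v ^ (k : ℝ)

/-- `O_M^×(ℝ^p, ℝ^p)`: diffeomorphisms `g` of `ℝ^p` with `g` and `g⁻¹` in `O_M`. -/
def OMX {p : ℕ} (g : (Fin p → ℝ) → (Fin p → ℝ)) : Prop :=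
  ∃ h : (Fin p → ℝ) → (Fin p → ℝ),
    Function.LeftInverse h g ∧ Function.RightInverse h g ∧ OMCl g ∧ OMCl h

/-- The symbol space `S_σ^{l,m}(ℝ^{2n}, E)`. -/
def Ssym {n : ℕ} {E : Type*} [NormedAddCommGroup E] [NormedSpace ℝ E]
    (σ l m : ℝ) (a : (Fin n → ℝ) → (Fin n → ℝ) → E) : Prop :=
  ContDiff ℝ (⊤ : ℕ∞) (fun q : (Fin n → ℝ) × (Fin n → ℝ) => a q.1 q.2) ∧
  ∀ α β : Fin n → ℕ, ∃ C > 0, ∀ x ϑ,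
    ‖pdm2 α β a x ϑ‖ ≤ C * jb x ^ (σ * (l - (msize α : ℝ))) * jb ϑ ^ (m - (msize β : ℝ))

/-- The amplitude space `Π_{σ,κ}^{l,w,m}(ℝ^{3n}, E)`. -/
def Amp {n : ℕ} {E : Type*} [NormedAddCommGroup E] [NormedSpace ℝ E]
    (σ κ l w m : ℝ) (a : (Fin n → ℝ) → (Fin n → ℝ) → (Fin n → ℝ) → E) : Prop :=
  ContDiff ℝ (⊤ : ℕ∞)
    (fun q : ((Fin n → ℝ) × (Fin n → ℝ)) × (Fin n → ℝ) => a q.1.1 q.1.2 q.2) ∧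
  ∀ α β γ : Fin n → ℕ, ∃ C > 0, ∀ x ζ ϑ,
    ‖pdm3 α β γ a x ζ ϑ‖ ≤
      C * jb x ^ (σ * (l - ((msize α + msize β : ℕ) : ℝ))) *
        jb ζ ^ (w + κ * ((msize α + msize β : ℕ) : ℝ)) * jb ϑ ^ (m - (msize γ : ℝ))

/-- The space `H_{σ,κ}^{w}(E)` of smooth functions on `ℝ^{2n}`. -/
def Hsp {n : ℕ} {F : Type*} [NormedAddCommGroup F] [NormedSpace ℝ F]
    (σ κ w : ℝ) (g : (Fin n → ℝ) → (Fin n → ℝ) → F) : Prop :=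
  ContDiff ℝ (⊤ : ℕ∞) (fun q : (Fin n → ℝ) × (Fin n → ℝ) => g q.1 q.2) ∧
  ∀ α β : Fin n → ℕ, ¬(α = 0 ∧ β = 0) → ∃ C > 0, ∀ x ζ,
    ‖pdm2 α β g x ζ‖ ≤ C * jb x ^ (-(σ * (((msize α + msize β : ℕ) : ℝ) - 1))) *
      jb ζ ^ (w + κ * (((msize α + msize β : ℕ) : ℝ) - 1))

/-- The space `E_{σ,κ}^{w}(E)` of smooth functions on `ℝ^{2n}`. -/
def Esp {n : ℕ} {F : Type*} [NormedAddCommGroup F] [NormedSpace ℝ F]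
    (σ κ w : ℝ) (g : (Fin n → ℝ) → (Fin n → ℝ) → F) : Prop :=
  ContDiff ℝ (⊤ : ℕ∞) (fun q : (Fin n → ℝ) × (Fin n → ℝ) => g q.1 q.2) ∧
  ∀ α β : Fin n → ℕ, ∃ C > 0, ∀ x ζ,
    ‖pdm2 α β g x ζ‖ ≤ C * jb x ^ (-(σ * ((msize α + msize β : ℕ) : ℝ))) *
      jb ζ ^ (w + κ * ((msize α + msize β : ℕ) : ℝ))

/-- Jacobian determinant of a map `ℝ^p → ℝ^p`. -/
def Jdet {p : ℕ} (g : (Fin p → ℝ) → (Fin p → ℝ)) : (Fin p → ℝ) → ℝ :=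
  fun v => LinearMap.det (fderiv ℝ g v).toLinearMap

/-- The seminorm `q_{p,(α,β)}(K) = sup ⟨(x,y)⟩^p |∂^{(α,β)} K (x,y)|`. -/
def qSem {n : ℕ} (p : ℕ) (α β : Fin n → ℕ)
    (K : (Fin n → ℝ) → (Fin n → ℝ) → ℂ) : ℝ :=
  ⨆ q : (Fin n → ℝ) × (Fin n → ℝ), jb2 q.1 q.2 ^ p * ‖pdm2 α β K q.1 q.2‖

/-- Mixed partial derivative `∂_r^α ∂_θ^β` of a function of two real variables. -/
def pd2 (α β : ℕ) (F : ℝ → ℝ → ℝ) (r θ : ℝ) : ℝ :=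
  iteratedDeriv α (fun r' => iteratedDeriv β (fun θ' => F r' θ') θ) r

/-- Smooth real function on `ℝ` with all derivatives bounded. -/
def BddSmooth (a : ℝ → ℝ) : Prop :=
  ContDiff ℝ (⊤ : ℕ∞) a ∧ ∀ k : ℕ, ∃ C : ℝ, ∀ t, |iteratedDeriv k a t| ≤ C

/-- Inverse hyperbolic cosine, `arcosh x = log (x + √(x²-1))`. -/
def arcosh (x : ℝ) : ℝ := Real.log (x + Real.sqrt (x ^ 2 - 1))

/-! ### Helper material -/

lemma jb_one_le {n : ℕ} (v : Fin n → ℝ) : 1 ≤ jb v := by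
  unfold jb
  rw [Real.one_le_sqrt]
  have : 0 ≤ ∑ i, (v i) ^ 2 := Finset.sum_nonneg fun i _ => sq_nonneg _
  linarith

/-- Iterated partial derivative along a list of directions. -/
def pdl {n : ℕ} {E : Type*} [NormedAddCommGroup E] [NormedSpace ℝ E]
    (l : List (Fin n)) (f : (Fin n → ℝ) → E) : (Fin n → ℝ) → E :=
  l.foldr (fun i g => pd i g) f

section Aux

variable {n : ℕ} {E : Type*} [NormedAddCommGroup E] [NormedSpace ℝ E]

lemma pd_smooth (i : Fin n) {f : (Fin n → ℝ) → E} (hf : ContDiff ℝ (⊤ : ℕ∞) f) :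
    ContDiff ℝ (⊤ : ℕ∞) (pd i f) := by
  unfold pd
  have h : ContDiff ℝ (⊤ : ℕ∞) (fderiv ℝ f) := hf.fderiv_right (by simp)
  exact h.clm_apply contDiff_const

lemma pdl_smooth (l : List (Fin n)) {f : (Fin n → ℝ) → E} (hf : ContDiff ℝ (⊤ : ℕ∞) f) :
    ContDiff ℝ (⊤ : ℕ∞) (pdl l f) := by
  induction l with
  | nil => exact hf
  | cons i l ih => exact pd_smooth i ih

lemma pd_comm (i j : Fin n) {f : (Fin n → ℝ) → E} (hf : ContDiff ℝ (⊤ : ℕ∞) f) :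
    pd i (pd j f) = pd j (pd i f) := by
  have h : ContDiff ℝ (⊤ : ℕ∞) (fderiv ℝ f) := hf.fderiv_right (by simp)
  have key : ∀ (a b : Fin n) (x : Fin n → ℝ), pd a (pd b f) x
      = fderiv ℝ (fderiv ℝ f) x (Pi.single a 1) (Pi.single b 1) := by
    intro a b x
    have hd : DifferentiableAt ℝ (fderiv ℝ f) x := (h.differentiable (by simp)) x
    unfold pd
    rw [fderiv_clm_apply hd (differentiableAt_const _)]
    simp
  funext x
  rw [key, key]
  have hs : IsSymmSndFDerivAt ℝ f x :=
    hf.contDiffAt.isSymmSndFDerivAt (by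
      rw [minSmoothness_of_isRCLikeNormedField]
      exact WithTop.coe_le_coe.2 (le_top : (2 : ℕ∞) ≤ ⊤))
  exact hs _ _

lemma pdl_perm {l l' : List (Fin n)} (h : l.Perm l') {f : (Fin n → ℝ) → E}
    (hf : ContDiff ℝ (⊤ : ℕ∞) f) : pdl l f = pdl l' f := by
  induction h with
  | nil => rfl
  | cons i _ ih => 
    change pd i (pdl _ f) = pd i (pdl _ f)
    rw [ih]
  | swap i j l => exact pd_comm _ _ (pdl_smooth l hf)
  | trans _ _ h1 h2 => exact h1.trans h2

lemma pdl_eq (l : List (Fin n)) {f : (Fin n → ℝ) → E} (hf : ContDiff ℝ (⊤ : ℕ∞) f)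
    (x : Fin n → ℝ) :
    pdl l f x = iteratedFDeriv ℝ l.length f x (fun j => Pi.single (l.get j) (1 : ℝ)) := by
  induction l generalizing x with
  | nil => simp [pdl]
  | cons i l ih =>
    change fderiv ℝ (pdl l f) x (Pi.single i 1) = _
    rw [show pdl l f = _ from funext ih]
    have hd : DifferentiableAt ℝ (iteratedFDeriv ℝ l.length f) x :=
      (hf.differentiable_iteratedFDeriv (by exact_mod_cast ENat.natCast_lt_top _)) x
    have h2 := hd.iteratedFDeriv_succ_apply_left'
      (m := fun j : Fin (l.length + 1) => Pi.single ((i :: l).get j) (1 : ℝ))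
    exact h2.symm

lemma pd_iter (i : Fin n) (k : ℕ) (f : (Fin n → ℝ) → E) :
    (pd i)^[k] f = pdl (List.replicate k i) f := by
  induction k with
  | zero => rfl
  | succ k ih =>
    rw [Function.iterate_succ_apply', ih]
    rfl

lemma pdm_aux (ν : Fin n → ℕ) (f : (Fin n → ℝ) → E) (L : List (Fin n)) :
    L.foldr (fun i g => (pd i)^[ν i] g) f
      = pdl (L.flatMap fun i => List.replicate (ν i) i) f := by
  induction L with
  | nil => rfl
  | cons i L ih =>
    rw [List.foldr_cons, ih, pd_iter, List.flatMap_cons]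
    simp [pdl, List.foldr_append]

/-- canonical list of a multi-index -/
def canon (ν : Fin n → ℕ) : List (Fin n) :=
  (List.finRange n).flatMap fun i => List.replicate (ν i) i

lemma pdm_eq (ν : Fin n → ℕ) (f : (Fin n → ℝ) → E) : pdm ν f = pdl (canon ν) f :=
  pdm_aux ν f _

lemma canon_length (ν : Fin n → ℕ) : (canon ν).length = msize ν := by
  simp [canon, msize, List.length_flatMap, List.sum_ofFn, ← List.ofFn_eq_map]

lemma canon_count (ν : Fin n → ℕ) (j : Fin n) : (canon ν).count j = ν j := by
  simp only [canon, List.count_flatMap, ← List.ofFn_eq_map, List.sum_ofFn]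
  simp [List.count_replicate]

lemma canon_perm (l : List (Fin n)) : l.Perm (canon fun i => l.count i) := by
  rw [List.perm_iff_count]
  intro a
  rw [canon_count]

lemma norm_pdm_le (ν : Fin n → ℕ) {f : (Fin n → ℝ) → E} (hf : ContDiff ℝ (⊤ : ℕ∞) f)
    (x : Fin n → ℝ) : ‖pdm ν f x‖ ≤ ‖iteratedFDeriv ℝ (msize ν) f x‖ := by
  rw [pdm_eq, pdl_eq _ hf, ← canon_length]
  refine (ContinuousMultilinearMap.le_opNorm _ _).trans ?_
  have h1 : ∀ i : Fin n, ‖(Pi.single i (1 : ℝ) : Fin n → ℝ)‖ = 1 := by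
    intro i
    rw [Pi.norm_single, norm_one]
  rw [Finset.prod_congr rfl fun j _ => h1 _]
  simp

lemma norm_iter_le (k : ℕ) {f : (Fin n → ℝ) → E} (hf : ContDiff ℝ (⊤ : ℕ∞) f)
    (x : Fin n → ℝ) : ‖iteratedFDeriv ℝ k f x‖ ≤
      ∑ r : Fin k → Fin n, ‖pdm (fun i => (List.ofFn r).count i) f x‖ := by
  refine ContinuousMultilinearMap.opNorm_le_bound
    (Finset.sum_nonneg fun _ _ => norm_nonneg _) fun m => ?_
  have hr : ∀ r : Fin k → Fin n, pdm (fun i => (List.ofFn r).count i) f x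
      = iteratedFDeriv ℝ k f x (fun j => Pi.single (r j) (1 : ℝ)) := by
    intro r
    rw [pdm_eq, ← pdl_perm (canon_perm (List.ofFn r)) hf, pdl_eq _ hf]
    have gen : ∀ (k' : ℕ) (h : k' = k), 
        iteratedFDeriv ℝ k' f x (fun j => Pi.single (r (Fin.cast h j)) (1 : ℝ))
         = iteratedFDeriv ℝ k f x (fun j => Pi.single (r j) (1 : ℝ)) := by
      rintro _ rfl; rfl
    rw [← gen _ (List.length_ofFn (f := r))]
    congr 1
    funext j
    simp
    rfl
  have hm : m = fun j => ∑ i, m j i • (Pi.single i (1 : ℝ) : Fin n → ℝ) := by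
    funext j
    exact pi_eq_sum_univ' (m j)
  have e1 : iteratedFDeriv ℝ k f x m = ∑ r : Fin k → Fin n,
      (∏ j, m j (r j)) • iteratedFDeriv ℝ k f x (fun j => Pi.single (r j) (1 : ℝ)) := by
    conv_lhs => rw [hm]
    rw [ContinuousMultilinearMap.map_sum]
    exact Finset.sum_congr rfl fun r _ => ContinuousMultilinearMap.map_smul_univ _ _ _
  rw [e1, Finset.sum_mul]
  refine (norm_sum_le _ _).trans (Finset.sum_le_sum fun r _ => ?_)
  rw [norm_smul, hr, mul_comm, norm_prod]
  gcongr with j _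
  exact norm_le_pi_norm (m j) (r j)

/-- Bound of order `a` on all derivatives of positive order, by multi-indices. -/
lemma mi_iff (σ a : ℝ) {f : (Fin n → ℝ) → E} (hf : ContDiff ℝ (⊤ : ℕ∞) f) :
    (∀ ν : Fin n → ℕ, ν ≠ 0 → ∃ C > 0, ∀ v,
      ‖pdm ν f v‖ ≤ C * jb v ^ (-(σ * ((msize ν : ℝ) - a)))) ↔
    (∀ k : ℕ, 1 ≤ k → ∃ C > 0, ∀ v,
      ‖iteratedFDeriv ℝ k f v‖ ≤ C * jb v ^ (-(σ * ((k : ℝ) - a)))) := by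
  constructor
  · intro H k hk
    have hsz : ∀ r : Fin k → Fin n, msize (fun i => (List.ofFn r).count i) = k := by
      intro r
      rw [← canon_length, ← (canon_perm (List.ofFn r)).length_eq, List.length_ofFn]
    have H' : ∀ r : Fin k → Fin n, ∃ C > 0, ∀ v,
        ‖pdm (fun i => (List.ofFn r).count i) f v‖ ≤ C * jb v ^ (-(σ * ((k : ℝ) - a))) := by
      intro r
      have := H (fun i => (List.ofFn r).count i) (by
        intro h0
        have := hsz r
        rw [h0] at this
        simp [msize] at this
        omega)
      rwa [hsz r] at this
    choose C hC hb using H'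
    refine ⟨∑ r, C r + 1, by
      have : 0 ≤ ∑ r, C r := Finset.sum_nonneg fun r _ => (hC r).le
      linarith, fun v => ?_⟩
    have hp : 0 ≤ jb v ^ (-(σ * ((k : ℝ) - a))) :=
      Real.rpow_nonneg (zero_le_one.trans (jb_one_le v)) _
    refine (norm_iter_le k hf v).trans ?_
    refine (Finset.sum_le_sum fun r _ => hb r v).trans ?_
    rw [← Finset.sum_mul]
    nlinarith
  · intro H ν hν
    have h1 : 1 ≤ msize ν := by
      by_contra h
      apply hν
      have h0 : ∑ i, ν i = 0 := by
        unfold msize at h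
        omega
      funext i
      exact (Finset.sum_eq_zero_iff.1 h0) i (Finset.mem_univ i)
    obtain ⟨C, hC, hb⟩ := H _ h1
    exact ⟨C, hC, fun v => (norm_pdm_le ν hf v).trans (hb v)⟩

end Aux

lemma core {p n : ℕ} {E : Type*} [NormedAddCommGroup E] [NormedSpace ℝ E]
    (σ a : ℝ) (hσ : 0 ≤ σ) (ha : a ≤ 1) {f : (Fin p → ℝ) → E} {g : (Fin n → ℝ) → (Fin p → ℝ)}
    (hf : ContDiff ℝ (⊤ : ℕ∞) f) (hg : ContDiff ℝ (⊤ : ℕ∞) g)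
    (hlow : 0 < σ → ∃ ε > 0, ∀ v, ε * jb v ≤ jb (g v))
    (Hf : ∀ k : ℕ, 1 ≤ k → ∃ C > 0, ∀ v,
      ‖iteratedFDeriv ℝ k f v‖ ≤ C * jb v ^ (-(σ * ((k : ℝ) - a))))
    (Hg : ∀ k : ℕ, 1 ≤ k → ∃ C > 0, ∀ v,
      ‖iteratedFDeriv ℝ k g v‖ ≤ C * jb v ^ (-(σ * ((k : ℝ) - 1)))) :
    ∀ k : ℕ, 1 ≤ k → ∃ C > 0, ∀ v,
      ‖iteratedFDeriv ℝ k (f ∘ g) v‖ ≤ C * jb v ^ (-(σ * ((k : ℝ) - a))) := by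
  have Hfg : ∀ k : ℕ, ∃ C > 0, 1 ≤ k → ∀ v,
      ‖iteratedFDeriv ℝ k f (g v)‖ ≤ C * jb v ^ (-(σ * ((k : ℝ) - a))) := by
    intro k
    by_cases hk : 1 ≤ k
    swap
    · exact ⟨1, one_pos, fun h => absurd h hk⟩
    obtain ⟨C, hC, hb⟩ := Hf k hk
    have hk' : (1 : ℝ) ≤ k := by exact_mod_cast hk
    rcases hσ.eq_or_lt with h0 | h0
    · refine ⟨C, hC, fun _ v => ?_⟩
      simpa [← h0] using hb (g v)
    · obtain ⟨ε, hε, hl⟩ := hlow h0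
      refine ⟨C * ε ^ (-(σ * ((k : ℝ) - a))), by positivity, fun _ v => (hb _).trans ?_⟩
      have hj : 0 < jb v := one_pos.trans_le (jb_one_le v)
      rw [mul_assoc, ← Real.mul_rpow hε.le hj.le]
      refine mul_le_mul_of_nonneg_left ?_ hC.le
      refine Real.rpow_le_rpow_of_nonpos (by positivity) (hl v) ?_
      have : 0 ≤ σ * ((k : ℝ) - a) := mul_nonneg hσ (by linarith)
      linarith
  have Hg' : ∀ k : ℕ, ∃ C > 0, 1 ≤ k → ∀ v,
      ‖iteratedFDeriv ℝ k g v‖ ≤ C * jb v ^ (-(σ * ((k : ℝ) - 1))) := by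
    intro k
    by_cases hk : 1 ≤ k
    · obtain ⟨C, hC, hb⟩ := Hg k hk
      exact ⟨C, hC, fun _ => hb⟩
    · exact ⟨1, one_pos, fun h => absurd h hk⟩
  choose A hA hAb using Hfg
  choose B hB hBb using Hg'
  intro k hk
  set A' : ℝ := ∑ i ∈ Finset.range (k + 1), A i with hA'
  set B' : ℝ := 1 + ∑ i ∈ Finset.range (k + 1), B i with hB'
  have hAle : ∀ i ≤ k, A i ≤ A' := fun i hi =>
    Finset.single_le_sum (f := A) (fun j _ => (hA j).le) (Finset.mem_range.2 (by omega))
  have hBle : ∀ i ≤ k, B i ≤ B' := fun i hi => by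
    have := Finset.single_le_sum (f := B) (fun j _ => (hB j).le)
      (Finset.mem_range.2 (show i < k + 1 by omega))
    linarith
  have hA'pos : 0 < A' := (hA 0).trans_le (hAle 0 (Nat.zero_le _))
  have hB'one : 1 ≤ B' := by
    have : 0 ≤ ∑ i ∈ Finset.range (k + 1), B i := Finset.sum_nonneg fun i _ => (hB i).le
    linarith
  have hB'pos : 0 < B' := one_pos.trans_le hB'one
  refine ⟨k.factorial * A' * B' ^ k, by positivity, fun v => ?_⟩
  have hj : 0 < jb v := one_pos.trans_le (jb_one_le v)
  set L : ℝ := jb v ^ σ with hL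
  have hLpos : 0 < L := Real.rpow_pos_of_pos hj _
  have hpow : ∀ (i : ℕ) (b : ℝ), jb v ^ (-(σ * ((i : ℝ) - b))) = L ^ b * (L⁻¹) ^ i := by
    intro i b
    rw [show -(σ * ((i : ℝ) - b)) = σ * b + σ * (-(i : ℝ)) by ring, Real.rpow_add hj,
      Real.rpow_mul hj.le, Real.rpow_mul hj.le, ← hL, Real.rpow_neg hLpos.le,
      Real.rpow_natCast, inv_pow]
  -- rescaled functions
  set c : E := f (g v) with hc
  have hf1 : ContDiff ℝ (⊤ : ℕ∞) (fun y => f y - c) := hf.sub contDiff_const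
  have hF : ContDiff ℝ (⊤ : ℕ∞) (fun y => f (L • y) - c) :=
    hf1.comp (contDiff_const_smul L)
  have hG : ContDiff ℝ (⊤ : ℕ∞) (fun x => L⁻¹ • g x) := hg.const_smul _
  have hsub : ∀ {q : ℕ} (h : (Fin q → ℝ) → E) (_ : ContDiff ℝ (⊤ : ℕ∞) h) (i : ℕ), 1 ≤ i →
      iteratedFDeriv ℝ i (fun y => h y - c) = iteratedFDeriv ℝ i h := by
    intro q h hh i hi
    have := iteratedFDeriv_sub (𝕜 := ℝ) (i := i) (f := h) (g := fun _ => c)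
      (hh.of_le (by exact_mod_cast le_top)) contDiff_const
    rw [iteratedFDeriv_const_of_ne (by omega), sub_zero] at this
    exact this
  have hcomp : (fun x => (f ∘ g) x - c) = (fun y => f (L • y) - c) ∘ (fun x => L⁻¹ • g x) := by
    funext x
    simp [smul_smul, hLpos.ne']
  rw [← hsub (f ∘ g) (hf.comp hg) k hk, hcomp]
  have main := norm_iteratedFDeriv_comp_le (n := k) hF hG (by exact_mod_cast le_top) v
    (C := A' * L ^ a) (D := B' * L⁻¹) ?_ ?_
  · rw [hpow]
    calc _ ≤ _ := main
      _ = _ := by rw [mul_pow]; ring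
  · intro i hi
    rcases Nat.eq_zero_or_pos i with h0 | h0
    · subst h0
      have : (0 : ℝ) ≤ A' * L ^ a := by positivity
      simpa [smul_smul, hLpos.ne', ← hc] using this
    · have e := iteratedFDeriv_comp_const_smul (𝕜 := ℝ) (i := i) (f := f) L
        (hf.of_le (by exact_mod_cast le_top))
      rw [hsub (fun y => f (L • y)) (hf.comp (contDiff_const_smul L)) i h0, e]
      simp only [smul_smul, mul_inv_cancel₀ hLpos.ne', one_smul]
      rw [norm_smul, norm_pow, Real.norm_of_nonneg hLpos.le]
      have h1 := hAb i h0 v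
      rw [hpow] at h1
      calc L ^ i * ‖iteratedFDeriv ℝ i f (g v)‖
          ≤ L ^ i * (A i * (L ^ a * L⁻¹ ^ i)) := by gcongr
        _ = A i * L ^ a := by
          rw [inv_pow]; field_simp
        _ ≤ A' * L ^ a := by
          gcongr
          exact hAle i hi
  · intro i h0 hi
    rw [iteratedFDeriv_const_smul_apply' (hg.contDiffAt.of_le (by exact_mod_cast le_top)),
      norm_smul, Real.norm_of_nonneg (by positivity)]
    have h1 := hBb i h0 v
    rw [hpow, Real.rpow_one] at h1
    calc L⁻¹ * ‖iteratedFDeriv ℝ i g v‖ ≤ L⁻¹ * (B i * (L * L⁻¹ ^ i)) := by gcongr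
      _ = B i * L⁻¹ ^ i := by field_simp
      _ ≤ B' ^ i * L⁻¹ ^ i := by
        gcongr
        exact (hBle i hi).trans (le_self_pow₀ hB'one (by omega))
      _ = _ := (mul_pow _ _ _).symm

/-- Stability of the classes `G_σ` and `S_σ` under composition with
a `G_σ` map whose bracket grows at least linearly (when `σ > 0`). -/
theorem statement0 {p n : ℕ} {E : Type*} [NormedAddCommGroup E] [NormedSpace ℝ E]
    [FiniteDimensional ℝ E]
    (σ : ℝ) (hσ : σ ∈ Set.Icc (0 : ℝ) 1)
    (f : (Fin p → ℝ) → E) (f' : (Fin p → ℝ) → ℝ)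
    (g : (Fin n → ℝ) → (Fin p → ℝ))
    (hg : GsigmaCl σ g)
    (hlow : 0 < σ → ∃ ε > 0, ∀ v, ε * jb v ≤ jb (g v)) :
    (GsigmaCl σ f → GsigmaCl σ (f ∘ g)) ∧ (SsigmaCl σ f' → SsigmaCl σ (f' ∘ g)) := by
  obtain ⟨hgs, hgb⟩ := hg
  have Hg := (mi_iff σ 1 hgs).1 hgb
  constructor
  · rintro ⟨hfs, hfb⟩
    have hs : ContDiff ℝ (⊤ : ℕ∞) (f ∘ g) := hfs.comp hgs
    exact ⟨hs, (mi_iff σ 1 hs).2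
      (core σ 1 hσ.1 le_rfl hfs hgs hlow ((mi_iff σ 1 hfs).1 hfb) Hg)⟩
  · rintro ⟨hfs, hfb⟩
    have hs : ContDiff ℝ (⊤ : ℕ∞) (f' ∘ g) := hfs.comp hgs
    have Hf := (mi_iff σ 0 hfs).1 (fun ν _ => by simpa using hfb ν)
    have H := (mi_iff σ 0 hs).2 (core σ 0 hσ.1 zero_le_one hfs hgs hlow Hf Hg)
    refine ⟨hs, fun ν => ?_⟩
    by_cases hν : ν = 0
    · subst hν
      obtain ⟨C, hC, hb⟩ := hfb 0
      have h0 : ∀ (q : ℕ) (h : (Fin q → ℝ) → ℝ), pdm 0 h = h := by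
        intro q h
        rw [pdm_eq]
        have : canon (0 : Fin q → ℕ) = [] := by
          apply List.eq_nil_of_length_eq_zero
          rw [canon_length]
          simp [msize]
        rw [this]
        rfl
      refine ⟨C, hC, fun v => ?_⟩
      have := hb (g v)
      rw [h0] at this ⊢
      simpa [msize] using this
    · simpa using H ν hν
end
end

section
/- Let n ∈ ℕ*, r ∈ ℕ, C₁ > 0, and let μ : ℝ^n → ℝ be continuous with |μ(t)| ≤ C₁⟨t⟩^{r-n-1} for all t. For K, K' ∈ S(ℝ^{2n}) define (K·K')(x, y) := ∫_{ℝ^n} K(x, t) K'(t, y) μ(t) dt. Then K·K' is a Schwartz function on ℝ^{2n} and for every p ∈ ℕ and all multi-indices α, β ∈ ℕ^n one has q_{p,(α,β)}(K·K') ≤ C · q_{2(p+r),(α,0)}(K) · q_{p,(0,β)}(K'), where C := C₁ ∫_{ℝ^n} ⟨t⟩^{-(n+1)} dt and q_{p,ν}(K) := sup_{(x,y)∈ℝ^{2n}} ⟨(x,y)⟩^p |∂^ν K(x,y)|. -/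
open MeasureTheory
open scoped BigOperators

noncomputable section

section helpers
open scoped SchwartzMap ContDiff LineDeriv

theorem aux_schwartz_bound {E F : Type*} [NormedAddCommGroup E] [NormedSpace ℝ E]
    [NormedAddCommGroup F] [NormedSpace ℝ F] (f : 𝓢(E, F)) (k n : ℕ) :
    ∃ C : ℝ, 0 ≤ C ∧ ∀ x, (1 + ‖x‖) ^ k * ‖iteratedFDeriv ℝ n f x‖ ≤ C := by
  refine ⟨_, ?_, fun x => SchwartzMap.one_add_le_sup_seminorm_apply (𝕜 := ℝ) (m := (k, n))
    le_rfl le_rfl f x⟩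
  positivity

theorem aux_schwartz_bound0 {E F : Type*} [NormedAddCommGroup E] [NormedSpace ℝ E]
    [NormedAddCommGroup F] [NormedSpace ℝ F] (f : 𝓢(E, F)) (k : ℕ) :
    ∃ C : ℝ, 0 ≤ C ∧ ∀ x, (1 + ‖x‖) ^ k * ‖f x‖ ≤ C := by
  obtain ⟨C, hC, h⟩ := aux_schwartz_bound f k 0
  exact ⟨C, hC, fun x => by simpa using h x⟩

theorem aux_comp_bound {Z E F : Type*} [NormedAddCommGroup E] [NormedSpace ℝ E]
    [NormedAddCommGroup Z] [NormedSpace ℝ Z]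
    [NormedAddCommGroup F] [NormedSpace ℝ F] (L : Z →L[ℝ] E) (f : 𝓢(E, F)) (k n : ℕ) :
    ∃ C : ℝ, 0 ≤ C ∧ ∀ z, (1 + ‖L z‖) ^ k * ‖iteratedFDeriv ℝ n (fun z => f (L z)) z‖ ≤ C := by
  obtain ⟨C, hC, h⟩ := aux_schwartz_bound f k n
  refine ⟨C * ∏ _i : Fin n, ‖L‖, by positivity, fun z => ?_⟩
  have e : iteratedFDeriv ℝ n (fun z => f (L z)) z = _ :=
    L.iteratedFDeriv_comp_right (f := f) (f.smooth n) z (i := n) (by simp)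
  rw [e]
  calc _ ≤ (1 + ‖L z‖) ^ k * (‖iteratedFDeriv ℝ n f (L z)‖ * ∏ _i : Fin n, ‖L‖) := by
        gcongr; exact ContinuousMultilinearMap.norm_compContinuousLinearMap_le _ _
    _ = ((1 + ‖L z‖) ^ k * ‖iteratedFDeriv ℝ n f (L z)‖) * ∏ _i : Fin n, ‖L‖ := by ring
    _ ≤ _ := by gcongr; exact h _

/-- Product of two Schwartz functions pulled back along jointly proper linear maps. -/
def auxProd {Z E : Type*} [NormedAddCommGroup E] [NormedSpace ℝ E]
    [NormedAddCommGroup Z] [NormedSpace ℝ Z] (L M : Z →L[ℝ] E)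
    (hLM : ∀ z, ‖z‖ ≤ ‖L z‖ + ‖M z‖) (f g : 𝓢(E, ℂ)) : 𝓢(Z, ℂ) where
  toFun z := f (L z) * g (M z)
  smooth' := ((f.smooth ⊤).comp L.contDiff).mul ((g.smooth ⊤).comp M.contDiff)
  decay' := by
    intro k n
    choose C hC h using fun i => aux_comp_bound L f k i
    choose D hD h' using fun i => aux_comp_bound M g k i
    refine ⟨∑ i ∈ Finset.range (n + 1), (n.choose i : ℝ) * C i * D (n - i), fun z => ?_⟩
    have hf : ContDiff ℝ n (fun z => f (L z)) := (f.smooth n).comp L.contDiff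
    have hg : ContDiff ℝ n (fun z => g (M z)) := (g.smooth n).comp M.contDiff
    have hz : ‖z‖ ^ k ≤ (1 + ‖L z‖) ^ k * (1 + ‖M z‖) ^ k := by
      rw [← mul_pow]
      gcongr
      nlinarith [hLM z, norm_nonneg (L z), norm_nonneg (M z),
        mul_nonneg (norm_nonneg (L z)) (norm_nonneg (M z))]
    refine (mul_le_mul_of_nonneg_left (norm_iteratedFDeriv_mul_le hf hg z le_rfl)
      (by positivity)).trans ?_
    rw [Finset.mul_sum]
    refine Finset.sum_le_sum fun i _ => ?_
    calc _ ≤ ((1 + ‖L z‖) ^ k * (1 + ‖M z‖) ^ k) * ((n.choose i : ℝ) *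
          ‖iteratedFDeriv ℝ i (fun z => f (L z)) z‖ *
          ‖iteratedFDeriv ℝ (n - i) (fun z => g (M z)) z‖) := by gcongr
      _ = (n.choose i : ℝ) * ((1 + ‖L z‖) ^ k * ‖iteratedFDeriv ℝ i (fun z => f (L z)) z‖) *
          ((1 + ‖M z‖) ^ k * ‖iteratedFDeriv ℝ (n - i) (fun z => g (M z)) z‖) := by ring
      _ ≤ _ := by
        gcongr
        · exact mul_nonneg (by positivity) (hC i)
        · exact h i z
        · exact h' _ z

/-- Partial derivative in the first factor. -/
def auxD {E T F : Type*} [NormedAddCommGroup E] [NormedSpace ℝ E]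
    [NormedAddCommGroup T] [NormedSpace ℝ T] [NormedAddCommGroup F] [NormedSpace ℝ F]
    (G : 𝓢(E × T, F)) : 𝓢(E × T, E →L[ℝ] F) :=
  SchwartzMap.postcompCLM
    ((ContinuousLinearMap.compL ℝ E (E × T) F).flip (ContinuousLinearMap.inl ℝ E T))
    (SchwartzMap.fderivCLM ℝ (E × T) F G)

theorem auxD_apply {E T F : Type*} [NormedAddCommGroup E] [NormedSpace ℝ E]
    [NormedAddCommGroup T] [NormedSpace ℝ T] [NormedAddCommGroup F] [NormedSpace ℝ F]
    (G : 𝓢(E × T, F)) (z : E × T) :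
    auxD G z = (fderiv ℝ G z).comp (ContinuousLinearMap.inl ℝ E T) := rfl

section P
variable {E F : Type} [NormedAddCommGroup E] [NormedSpace ℝ E] [NormedAddCommGroup F]
  [NormedSpace ℝ F] {n : ℕ}

theorem aux_unif (r : ℕ) (C₂ : ℝ) (μ : (Fin n → ℝ) → ℝ)
    (hμ : ∀ t, |μ t| ≤ C₂ * (1 + ‖t‖) ^ r) (G : 𝓢(E × (Fin n → ℝ), F)) (k : ℕ) :
    ∃ C, 0 ≤ C ∧ ∀ q t, ‖q‖ ^ k * ‖μ t • G (q, t)‖ ≤ C * (1 + ‖t‖) ^ (-(n + 1 : ℝ)) := by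
  have hC₂ : 0 ≤ C₂ := by simpa using (abs_nonneg _).trans (hμ 0)
  obtain ⟨C, hC, h⟩ := aux_schwartz_bound0 G (k + r + (n + 1))
  refine ⟨C₂ * C, by positivity, fun q t => ?_⟩
  have e : (1 + ‖t‖) ^ (-(n + 1 : ℝ)) = ((1 + ‖t‖) ^ (n + 1))⁻¹ := by
    rw [Real.rpow_neg (by positivity)]; norm_cast
  rw [e, ← div_eq_mul_inv, le_div_iff₀ (by positivity), norm_smul, Real.norm_eq_abs]
  have h1 : ‖q‖ ≤ 1 + ‖(q, t)‖ := by
    have := norm_fst_le (q, t); simp only at this; linarith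
  have h2 : 1 + ‖t‖ ≤ 1 + ‖(q, t)‖ := by
    have := norm_snd_le (q, t); simp only at this; linarith
  calc ‖q‖ ^ k * (|μ t| * ‖G (q, t)‖) * (1 + ‖t‖) ^ (n + 1)
      ≤ (1 + ‖(q, t)‖) ^ k * ((C₂ * (1 + ‖(q, t)‖) ^ r) * ‖G (q, t)‖) *
        (1 + ‖(q, t)‖) ^ (n + 1) := by
        gcongr
        exact (hμ t).trans (by gcongr)
    _ = C₂ * ((1 + ‖(q, t)‖) ^ (k + r + (n + 1)) * ‖G (q, t)‖) := by ring
    _ ≤ _ := by gcongr; exact h _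

theorem aux_int_rpow : Integrable (fun t : Fin n → ℝ => (1 + ‖t‖) ^ (-(n + 1 : ℝ))) :=
  integrable_one_add_norm (by simp)

theorem aux_integrable (r : ℕ) (C₂ : ℝ) (μ : (Fin n → ℝ) → ℝ) (hμc : Continuous μ)
    (hμ : ∀ t, |μ t| ≤ C₂ * (1 + ‖t‖) ^ r) (G : 𝓢(E × (Fin n → ℝ), F)) (q : E) :
    Integrable (fun t => μ t • G (q, t)) := by
  obtain ⟨C, hC, h⟩ := aux_unif r C₂ μ hμ G 0
  refine (aux_int_rpow.const_mul C).mono' ?_ (Filter.Eventually.of_forall fun t => ?_)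
  · have := G.continuous
    exact Continuous.aestronglyMeasurable (by fun_prop)
  · simpa using h q t

theorem aux_hasFDerivAt (r : ℕ) (C₂ : ℝ) (μ : (Fin n → ℝ) → ℝ) (hμc : Continuous μ)
    (hμ : ∀ t, |μ t| ≤ C₂ * (1 + ‖t‖) ^ r) (G : 𝓢(E × (Fin n → ℝ), F)) (q : E) :
    HasFDerivAt (fun q => ∫ t, μ t • G (q, t)) (∫ t, μ t • auxD G (q, t)) q := by
  obtain ⟨C, hC, h⟩ := aux_unif r C₂ μ hμ (auxD G) 0
  refine hasFDerivAt_integral_of_dominated_of_fderiv_le (F := fun q t => μ t • G (q, t))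
    (F' := fun q t => μ t • auxD G (q, t))
    (bound := fun t => C * (1 + ‖t‖) ^ (-(n + 1 : ℝ))) Filter.univ_mem
    (Filter.Eventually.of_forall fun q =>
      (aux_integrable r C₂ μ hμc hμ G q).aestronglyMeasurable)
    (aux_integrable r C₂ μ hμc hμ G q)
    (aux_integrable r C₂ μ hμc hμ (auxD G) q).aestronglyMeasurable
    (Filter.Eventually.of_forall fun t q _ => by simpa using h q t)
    (aux_int_rpow.const_mul C)
    (Filter.Eventually.of_forall fun t q _ => ?_)
  refine HasFDerivAt.const_smul ?_ _
  rw [auxD_apply]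
  exact (G.hasFDerivAt (q, t)).comp q (hasFDerivAt_prodMk_left q t)

theorem aux_contDiff (r : ℕ) (C₂ : ℝ) (μ : (Fin n → ℝ) → ℝ) (hμc : Continuous μ)
    (hμ : ∀ t, |μ t| ≤ C₂ * (1 + ‖t‖) ^ r) (m : ℕ) :
    ∀ {F : Type} [NormedAddCommGroup F] [NormedSpace ℝ F] (G : 𝓢(E × (Fin n → ℝ), F)),
    ContDiff ℝ m (fun q => ∫ t, μ t • G (q, t)) := by
  induction m with
  | zero =>
    intro F _ _ G
    have : Differentiable ℝ (fun q => ∫ t, μ t • G (q, t)) :=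
      fun q => (aux_hasFDerivAt r C₂ μ hμc hμ G q).differentiableAt
    exact contDiff_zero.2 this.continuous
  | succ m ih =>
    intro F _ _ G
    push_cast
    rw [contDiff_succ_iff_hasFDerivAt]
    exact ⟨_, ih (auxD G), fun q => aux_hasFDerivAt r C₂ μ hμc hμ G q⟩

theorem aux_decay (r : ℕ) (C₂ : ℝ) (μ : (Fin n → ℝ) → ℝ) (hμc : Continuous μ)
    (hμ : ∀ t, |μ t| ≤ C₂ * (1 + ‖t‖) ^ r) (k m : ℕ) :
    ∀ {F : Type} [NormedAddCommGroup F] [NormedSpace ℝ F] (G : 𝓢(E × (Fin n → ℝ), F)),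
    ∃ C, ∀ q, ‖q‖ ^ k * ‖iteratedFDeriv ℝ m (fun q => ∫ t, μ t • G (q, t)) q‖ ≤ C := by
  induction m with
  | zero =>
    intro F _ _ G
    obtain ⟨C, hC, h⟩ := aux_unif r C₂ μ hμ G k
    refine ⟨∫ t : Fin n → ℝ, C * (1 + ‖t‖) ^ (-(n + 1 : ℝ)), fun q => ?_⟩
    rw [norm_iteratedFDeriv_zero]
    calc _ ≤ ‖q‖ ^ k * ∫ t, ‖μ t • G (q, t)‖ := by gcongr; exact norm_integral_le_integral_norm _
      _ = ∫ t, ‖q‖ ^ k * ‖μ t • G (q, t)‖ := by rw [integral_const_mul]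
      _ ≤ _ := integral_mono ((aux_integrable r C₂ μ hμc hμ G q).norm.const_mul _)
        (aux_int_rpow.const_mul C) (fun t => h q t)
  | succ m ih =>
    intro F _ _ G
    obtain ⟨C, h⟩ := ih (auxD G)
    refine ⟨C, fun q => ?_⟩
    rw [← norm_iteratedFDeriv_fderiv]
    have : fderiv ℝ (fun q => ∫ t, μ t • G (q, t)) = fun q => ∫ t, μ t • auxD G (q, t) :=
      funext fun q => (aux_hasFDerivAt r C₂ μ hμc hμ G q).fderiv
    rw [this]
    exact h q

/-- Partial integration of a Schwartz function against a weight. -/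
def auxP (r : ℕ) (C₂ : ℝ) (μ : (Fin n → ℝ) → ℝ) (hμc : Continuous μ)
    (hμ : ∀ t, |μ t| ≤ C₂ * (1 + ‖t‖) ^ r) (G : 𝓢(E × (Fin n → ℝ), F)) : 𝓢(E, F) where
  toFun q := ∫ t, μ t • G (q, t)
  smooth' := contDiff_infty.2 fun m => aux_contDiff r C₂ μ hμc hμ m G
  decay' k m := aux_decay r C₂ μ hμc hμ k m G
end P

theorem aux_pdm {n : ℕ} {S : Type*} (D : Fin n → S → S) (ev : S → (Fin n → ℝ) → ℂ)
    (h : ∀ i K, pd i (ev K) = ev (D i K)) (ν : Fin n → ℕ) (K : S) :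
    pdm ν (ev K) = ev ((List.finRange n).foldr (fun i g => (D i)^[ν i] g) K) := by
  have h2 : ∀ i (m : ℕ) K, (pd i)^[m] (ev K) = ev ((D i)^[m] K) := by
    intro i m
    induction m with
    | zero => intro K; rfl
    | succ m ih => intro K; rw [Function.iterate_succ_apply, h, ih, Function.iterate_succ_apply]
  unfold pdm
  induction (List.finRange n) with
  | nil => rfl
  | cons a l ih => simp only [List.foldr_cons]; rw [ih, h2]

theorem aux_pdm_zero {n : ℕ} (f : (Fin n → ℝ) → ℂ) : pdm 0 f = f := by
  unfold pdm
  induction (List.finRange n) with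
  | nil => rfl
  | cons a l ih => simp only [List.foldr_cons]; rw [ih]; rfl

theorem auxProd_fderiv {Z E : Type*} [NormedAddCommGroup E] [NormedSpace ℝ E]
    [NormedAddCommGroup Z] [NormedSpace ℝ Z] (L M : Z →L[ℝ] E)
    (hLM : ∀ z, ‖z‖ ≤ ‖L z‖ + ‖M z‖) (f g : 𝓢(E, ℂ)) (z v : Z) :
    fderiv ℝ (auxProd L M hLM f g) z v =
      fderiv ℝ f (L z) (L v) * g (M z) + f (L z) * fderiv ℝ g (M z) (M v) := by
  have h1 : HasFDerivAt (fun z => f (L z)) ((fderiv ℝ f (L z)).comp L) z :=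
    (f.hasFDerivAt (L z)).comp z L.hasFDerivAt
  have h2 : HasFDerivAt (fun z => g (M z)) ((fderiv ℝ g (M z)).comp M) z :=
    (g.hasFDerivAt (M z)).comp z M.hasFDerivAt
  have h3 : HasFDerivAt (auxProd L M hLM f g) _ z := h1.mul h2
  rw [h3.fderiv]
  simp
  ring

section kernels
variable {n : ℕ}

/-- The map `((x, y), t) ↦ (x, t)`. -/
def auxL (n : ℕ) : (((Fin n → ℝ) × (Fin n → ℝ)) × (Fin n → ℝ)) →L[ℝ]
    ((Fin n → ℝ) × (Fin n → ℝ)) :=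
  ((ContinuousLinearMap.fst ℝ _ _).comp (ContinuousLinearMap.fst ℝ _ _)).prod
    (ContinuousLinearMap.snd ℝ _ _)

/-- The map `((x, y), t) ↦ (t, y)`. -/
def auxM (n : ℕ) : (((Fin n → ℝ) × (Fin n → ℝ)) × (Fin n → ℝ)) →L[ℝ]
    ((Fin n → ℝ) × (Fin n → ℝ)) :=
  (ContinuousLinearMap.snd ℝ _ _).prod
    ((ContinuousLinearMap.snd ℝ _ _).comp (ContinuousLinearMap.fst ℝ _ _))

theorem auxLM (z : ((Fin n → ℝ) × (Fin n → ℝ)) × (Fin n → ℝ)) :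
    ‖z‖ ≤ ‖auxL n z‖ + ‖auxM n z‖ := by
  obtain ⟨⟨x, y⟩, t⟩ := z
  have h1 := norm_fst_le (x, t)
  have h2 := norm_snd_le (x, t)
  have h3 := norm_snd_le (t, y)
  have h4 := norm_nonneg (x, t)
  have h5 := norm_nonneg (t, y)
  change ‖((x, y), t)‖ ≤ ‖(x, t)‖ + ‖(t, y)‖
  rw [Prod.norm_def, Prod.norm_def]
  simp only at h1 h2 h3 ⊢
  refine max_le (max_le ?_ ?_) ?_ <;> linarith

/-- The Schwartz function `((x, y), t) ↦ K (x, t) * K' (t, y)`. -/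
def auxG (K K' : 𝓢((Fin n → ℝ) × (Fin n → ℝ), ℂ)) :
    𝓢(((Fin n → ℝ) × (Fin n → ℝ)) × (Fin n → ℝ), ℂ) :=
  auxProd (auxL n) (auxM n) auxLM K K'

/-- The product kernel. -/
def auxI (μ : (Fin n → ℝ) → ℝ) (K K' : 𝓢((Fin n → ℝ) × (Fin n → ℝ), ℂ))
    (x y : Fin n → ℝ) : ℂ := ∫ t, K (x, t) * K' (t, y) * (μ t : ℂ)

theorem auxI_eq (μ : (Fin n → ℝ) → ℝ) (K K' : 𝓢((Fin n → ℝ) × (Fin n → ℝ), ℂ))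
    (q : (Fin n → ℝ) × (Fin n → ℝ)) :
    auxI μ K K' q.1 q.2 = ∫ t, μ t • auxG K K' (q, t) := by
  unfold auxI
  congr 1
  ext t
  rw [Complex.real_smul, mul_comm]
  rfl

/-- Derivative in the `x` variable. -/
def auxX (i : Fin n) (K : 𝓢((Fin n → ℝ) × (Fin n → ℝ), ℂ)) :
    𝓢((Fin n → ℝ) × (Fin n → ℝ), ℂ) := ∂_{((Pi.single i 1, 0) : (Fin n → ℝ) × (Fin n → ℝ))} K

/-- Derivative in the `y` variable. -/
def auxY (i : Fin n) (K : 𝓢((Fin n → ℝ) × (Fin n → ℝ), ℂ)) :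
    𝓢((Fin n → ℝ) × (Fin n → ℝ), ℂ) := ∂_{((0, Pi.single i 1) : (Fin n → ℝ) × (Fin n → ℝ))} K

theorem aux_pdX (i : Fin n) (K : 𝓢((Fin n → ℝ) × (Fin n → ℝ), ℂ)) (y : Fin n → ℝ) :
    pd i (fun x => K (x, y)) = fun x => auxX i K (x, y) := by
  ext x
  have : HasFDerivAt (fun x => K (x, y)) _ x :=
    (K.hasFDerivAt (x, y)).comp x (hasFDerivAt_prodMk_left x y)
  unfold pd
  rw [this.fderiv]
  rfl

theorem aux_pdY (i : Fin n) (K : 𝓢((Fin n → ℝ) × (Fin n → ℝ), ℂ)) (x : Fin n → ℝ) :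
    pd i (fun y => K (x, y)) = fun y => auxY i K (x, y) := by
  ext y
  have : HasFDerivAt (fun y => K (x, y)) _ y :=
    (K.hasFDerivAt (x, y)).comp y (hasFDerivAt_prodMk_right x y)
  unfold pd
  rw [this.fderiv]
  rfl

theorem aux_fderiv_I (r : ℕ) (C₂ : ℝ) (μ : (Fin n → ℝ) → ℝ) (hμc : Continuous μ)
    (hμ : ∀ t, |μ t| ≤ C₂ * (1 + ‖t‖) ^ r) (K K' : 𝓢((Fin n → ℝ) × (Fin n → ℝ), ℂ))
    (q v : (Fin n → ℝ) × (Fin n → ℝ)) :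
    DifferentiableAt ℝ (fun q => auxI μ K K' q.1 q.2) q ∧
    fderiv ℝ (fun q => auxI μ K K' q.1 q.2) q v =
      ∫ t, (fderiv ℝ K (q.1, t) (v.1, 0) * K' (t, q.2) +
        K (q.1, t) * fderiv ℝ K' (t, q.2) (0, v.2)) * (μ t : ℂ) := by
  have h := aux_hasFDerivAt r C₂ μ hμc hμ (auxG K K') q
  simp_rw [← auxI_eq] at h
  refine ⟨h.differentiableAt, ?_⟩
  rw [h.fderiv, ContinuousLinearMap.integral_apply (aux_integrable r C₂ μ hμc hμ _ q)]
  congr 1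
  ext t
  rw [smul_apply, Complex.real_smul, mul_comm, auxD_apply]
  congr 1
  exact auxProd_fderiv (auxL n) (auxM n) auxLM K K' (q, t) (v, 0)

theorem aux_pdIX (r : ℕ) (C₂ : ℝ) (μ : (Fin n → ℝ) → ℝ) (hμc : Continuous μ)
    (hμ : ∀ t, |μ t| ≤ C₂ * (1 + ‖t‖) ^ r) (K' : 𝓢((Fin n → ℝ) × (Fin n → ℝ), ℂ))
    (y : Fin n → ℝ) (i : Fin n) (K : 𝓢((Fin n → ℝ) × (Fin n → ℝ), ℂ)) :
    pd i (fun x => auxI μ K K' x y) = fun x => auxI μ (auxX i K) K' x y := by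
  ext x
  obtain ⟨h1, h2⟩ := aux_fderiv_I r C₂ μ hμc hμ K K' (x, y) (Pi.single i 1, 0)
  have : HasFDerivAt (fun x => auxI μ K K' x y) _ x :=
    HasFDerivAt.comp (g := fun q : (Fin n → ℝ) × (Fin n → ℝ) => auxI μ K K' q.1 q.2)
      (f := fun x => (x, y)) x h1.hasFDerivAt (hasFDerivAt_prodMk_left x y)
  unfold pd
  rw [this.fderiv]
  refine Eq.trans h2 ?_
  unfold auxI
  congr 1
  ext t
  have e : fderiv ℝ K' (t, y) (0, 0) = 0 := map_zero _
  simp only [e, mul_zero, add_zero]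
  rfl

theorem aux_pdIY (r : ℕ) (C₂ : ℝ) (μ : (Fin n → ℝ) → ℝ) (hμc : Continuous μ)
    (hμ : ∀ t, |μ t| ≤ C₂ * (1 + ‖t‖) ^ r) (K : 𝓢((Fin n → ℝ) × (Fin n → ℝ), ℂ))
    (x : Fin n → ℝ) (i : Fin n) (K' : 𝓢((Fin n → ℝ) × (Fin n → ℝ), ℂ)) :
    pd i (fun y => auxI μ K K' x y) = fun y => auxI μ K (auxY i K') x y := by
  ext y
  obtain ⟨h1, h2⟩ := aux_fderiv_I r C₂ μ hμc hμ K K' (x, y) (0, Pi.single i 1)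
  have : HasFDerivAt (fun y => auxI μ K K' x y) _ y :=
    HasFDerivAt.comp (g := fun q : (Fin n → ℝ) × (Fin n → ℝ) => auxI μ K K' q.1 q.2)
      (f := fun y => (x, y)) y h1.hasFDerivAt (hasFDerivAt_prodMk_right x y)
  unfold pd
  rw [this.fderiv]
  refine Eq.trans h2 ?_
  unfold auxI
  congr 1
  ext t
  have e : fderiv ℝ K (x, t) (0, 0) = 0 := map_zero _
  simp only [e, zero_mul, zero_add]
  rfl

/-- Iterated `x` derivative. -/
def auxXm (α : Fin n → ℕ) (K : 𝓢((Fin n → ℝ) × (Fin n → ℝ), ℂ)) :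
    𝓢((Fin n → ℝ) × (Fin n → ℝ), ℂ) :=
  (List.finRange n).foldr (fun i g => (auxX i)^[α i] g) K

/-- Iterated `y` derivative. -/
def auxYm (α : Fin n → ℕ) (K : 𝓢((Fin n → ℝ) × (Fin n → ℝ), ℂ)) :
    𝓢((Fin n → ℝ) × (Fin n → ℝ), ℂ) :=
  (List.finRange n).foldr (fun i g => (auxY i)^[α i] g) K

theorem aux_pdm2_X (α : Fin n → ℕ) (K : 𝓢((Fin n → ℝ) × (Fin n → ℝ), ℂ)) (x y : Fin n → ℝ) :
    pdm2 α 0 (fun x y => K (x, y)) x y = auxXm α K (x, y) := by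
  unfold pdm2
  simp only [aux_pdm_zero]
  exact congrFun (aux_pdm auxX (fun K x => K (x, y)) (fun i K => aux_pdX i K y) α K) x

theorem aux_pdm2_Y (β : Fin n → ℕ) (K : 𝓢((Fin n → ℝ) × (Fin n → ℝ), ℂ)) (x y : Fin n → ℝ) :
    pdm2 0 β (fun x y => K (x, y)) x y = auxYm β K (x, y) := by
  unfold pdm2
  simp only [aux_pdm_zero]
  exact congrFun (aux_pdm auxY (fun K y => K (x, y)) (fun i K => aux_pdY i K x) β K) y

theorem aux_pdm2_I (r : ℕ) (C₂ : ℝ) (μ : (Fin n → ℝ) → ℝ) (hμc : Continuous μ)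
    (hμ : ∀ t, |μ t| ≤ C₂ * (1 + ‖t‖) ^ r) (K K' : 𝓢((Fin n → ℝ) × (Fin n → ℝ), ℂ))
    (α β : Fin n → ℕ) (x y : Fin n → ℝ) :
    pdm2 α β (auxI μ K K') x y = auxI μ (auxXm α K) (auxYm β K') x y := by
  unfold pdm2
  have h : ∀ x', pdm β (auxI μ K K' x') y = auxI μ K (auxYm β K') x' y := fun x' =>
    congrFun (aux_pdm auxY (fun K' y => auxI μ K K' x' y)
      (fun i K' => aux_pdIY r C₂ μ hμc hμ K x' i K') β K') y
  simp only [h]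
  exact congrFun (aux_pdm auxX (fun K x => auxI μ K (auxYm β K') x y)
      (fun i K => aux_pdIX r C₂ μ hμc hμ (auxYm β K') y i K) α K) x

theorem one_le_jb2 (x y : Fin n → ℝ) : 1 ≤ jb2 x y := by
  have h1 : 0 ≤ ∑ i, x i ^ 2 := Finset.sum_nonneg fun i _ => sq_nonneg _
  have h2 : 0 ≤ ∑ i, y i ^ 2 := Finset.sum_nonneg fun i _ => sq_nonneg _
  unfold jb2
  rw [Real.one_le_sqrt]; linarith

theorem one_le_jb (x : Fin n → ℝ) : 1 ≤ jb x := by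
  have h1 : 0 ≤ ∑ i, x i ^ 2 := Finset.sum_nonneg fun i _ => sq_nonneg _
  unfold jb
  rw [Real.one_le_sqrt]; linarith

theorem jb_le_jb2 (x t : Fin n → ℝ) : jb t ≤ jb2 x t := by
  have h1 : 0 ≤ ∑ i, x i ^ 2 := Finset.sum_nonneg fun i _ => sq_nonneg _
  unfold jb jb2
  apply Real.sqrt_le_sqrt; linarith

theorem jb2_le_mul (x y t : Fin n → ℝ) : jb2 x y ≤ jb2 x t * jb2 t y := by
  have h1 : 0 ≤ ∑ i, x i ^ 2 := Finset.sum_nonneg fun i _ => sq_nonneg _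
  have h2 : 0 ≤ ∑ i, y i ^ 2 := Finset.sum_nonneg fun i _ => sq_nonneg _
  have h3 : 0 ≤ ∑ i, t i ^ 2 := Finset.sum_nonneg fun i _ => sq_nonneg _
  unfold jb2
  rw [← Real.sqrt_mul (by positivity)]
  apply Real.sqrt_le_sqrt
  nlinarith [mul_nonneg h1 h2, mul_nonneg h1 h3, mul_nonneg h3 h3, mul_nonneg h3 h2]

theorem norm_le_jb (t : Fin n → ℝ) : ‖t‖ ≤ jb t := by
  rw [pi_norm_le_iff_of_nonneg (zero_le_one.trans (one_le_jb t))]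
  intro i
  refine Real.abs_le_sqrt ?_
  have := Finset.single_le_sum (f := fun i => t i ^ 2) (fun i _ => sq_nonneg _)
    (Finset.mem_univ i)
  linarith

theorem sum_sq_le (t : Fin n → ℝ) : ∑ i, t i ^ 2 ≤ n * ‖t‖ ^ 2 := by
  have : ∑ i, t i ^ 2 ≤ ∑ _i : Fin n, ‖t‖ ^ 2 := by
    refine Finset.sum_le_sum fun i _ => ?_
    rw [← sq_abs]
    gcongr
    exact norm_le_pi_norm t i
  simpa using this

theorem jb2_le (q : (Fin n → ℝ) × (Fin n → ℝ)) : jb2 q.1 q.2 ≤ (2 * n + 1) * (1 + ‖q‖) := by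
  unfold jb2
  refine Real.sqrt_le_iff.2 ⟨by positivity, ?_⟩
  have h1 := sum_sq_le q.1
  have h2 := sum_sq_le q.2
  have h3 : ‖q.1‖ ^ 2 ≤ ‖q‖ ^ 2 := by gcongr; exact norm_fst_le q
  have h4 : ‖q.2‖ ^ 2 ≤ ‖q‖ ^ 2 := by gcongr; exact norm_snd_le q
  have h5 : (n : ℝ) * ‖q.1‖ ^ 2 ≤ n * ‖q‖ ^ 2 := by gcongr
  have h6 : (n : ℝ) * ‖q.2‖ ^ 2 ≤ n * ‖q‖ ^ 2 := by gcongr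
  calc _ ≤ 1 + 2 * (n : ℝ) * ‖q‖ ^ 2 := by linarith
    _ ≤ (2 * n + 1) * (1 + ‖q‖) ^ 2 := by
      have : 0 ≤ (n : ℝ) * ‖q‖ := by positivity
      nlinarith [norm_nonneg q, sq_nonneg ‖q‖, (Nat.cast_nonneg n : (0 : ℝ) ≤ n)]
    _ ≤ (2 * n + 1) ^ 2 * (1 + ‖q‖) ^ 2 := by
      gcongr
      have : (0 : ℝ) ≤ n := Nat.cast_nonneg n
      nlinarith
    _ = _ := by ring

theorem jb_le (t : Fin n → ℝ) : jb t ≤ (2 * n + 1) * (1 + ‖t‖) := by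
  have := (jb_le_jb2 0 t).trans (jb2_le (0, t))
  simpa [Prod.norm_def] using this

theorem aux_bdd (k : ℕ) (K : 𝓢((Fin n → ℝ) × (Fin n → ℝ), ℂ)) :
    BddAbove (Set.range fun q : (Fin n → ℝ) × (Fin n → ℝ) => jb2 q.1 q.2 ^ k * ‖K q‖) := by
  obtain ⟨C, hC, h⟩ := aux_schwartz_bound0 K k
  refine ⟨(2 * n + 1) ^ k * C, ?_⟩
  rintro _ ⟨q, rfl⟩
  have h0 := zero_le_one.trans (one_le_jb2 q.1 q.2)
  calc jb2 q.1 q.2 ^ k * ‖K q‖ ≤ ((2 * n + 1) * (1 + ‖q‖)) ^ k * ‖K q‖ := by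
        gcongr; exact jb2_le q
    _ = (2 * n + 1) ^ k * ((1 + ‖q‖) ^ k * ‖K q‖) := by rw [mul_pow]; ring
    _ ≤ _ := by gcongr; exact h q

theorem aux_jb_cont : Continuous (fun t : Fin n → ℝ => jb t) := by
  unfold jb; fun_prop

theorem aux_jb_int : Integrable (fun t : Fin n → ℝ => jb t ^ (-(n + 1 : ℝ))) := by
  refine ((aux_int_rpow (n := n)).const_mul ((1 / 2 : ℝ) ^ (-(n + 1 : ℝ)))).mono' ?_
    (Filter.Eventually.of_forall fun t => ?_)
  · exact (aux_jb_cont.rpow_const fun t =>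
      Or.inl (zero_lt_one.trans_le (one_le_jb t)).ne').aestronglyMeasurable
  · have h0 := zero_lt_one.trans_le (one_le_jb t)
    rw [Real.norm_of_nonneg (by positivity), ← Real.mul_rpow (by positivity) (by positivity)]
    refine Real.rpow_le_rpow_of_nonpos (by positivity) ?_ (by linarith [(Nat.cast_nonneg n : (0:ℝ) ≤ n)])
    linarith [one_le_jb t, norm_le_jb t]

theorem aux_main (r : ℕ) (C₁ : ℝ) (hC₁ : 0 < C₁)
    (μ : (Fin n → ℝ) → ℝ) (hμ : ∀ t, |μ t| ≤ C₁ * jb t ^ ((r : ℝ) - n - 1))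
    (A B : 𝓢((Fin n → ℝ) × (Fin n → ℝ), ℂ)) (p : ℕ) (a b : ℝ)
    (ha : ∀ x t, jb2 x t ^ (2 * (p + r)) * ‖A (x, t)‖ ≤ a)
    (hb : ∀ t y, jb2 t y ^ p * ‖B (t, y)‖ ≤ b) (x y : Fin n → ℝ) :
    jb2 x y ^ p * ‖auxI μ A B x y‖ ≤
      (C₁ * ∫ t : Fin n → ℝ, jb t ^ (-(n + 1 : ℝ))) * a * b := by
  have h0 := zero_lt_one.trans_le (one_le_jb2 x y)
  have ha0 : 0 ≤ a := le_trans (mul_nonneg (pow_nonneg (zero_le_one.trans (one_le_jb2 0 0)) _) (norm_nonneg _)) (ha 0 0)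
  have key : ∀ t, ‖((jb2 x y ^ p : ℝ) : ℂ) * (A (x, t) * B (t, y) * (μ t : ℂ))‖ ≤
      (C₁ * a * b) * jb t ^ (-(n + 1 : ℝ)) := by
    intro t
    have hx := one_le_jb2 x t
    have hy := one_le_jb2 t y
    have ht := one_le_jb t
    have hx0 := zero_lt_one.trans_le hx
    have hy0 := zero_lt_one.trans_le hy
    have ht0 := zero_lt_one.trans_le ht
    have e : jb t ^ ((r : ℝ) - n - 1) = jb t ^ r * jb t ^ (-(n + 1 : ℝ)) := by
      rw [← Real.rpow_natCast, ← Real.rpow_add ht0]; congr 1; ring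
    have hp : jb2 x y ^ p * jb t ^ r ≤ jb2 x t ^ (2 * (p + r)) * jb2 t y ^ p := by
      calc _ ≤ (jb2 x t * jb2 t y) ^ p * jb2 x t ^ r := by
            gcongr
            · exact jb2_le_mul x y t
            · exact jb_le_jb2 x t
        _ = jb2 x t ^ (p + r) * jb2 t y ^ p := by ring
        _ ≤ _ := by
          gcongr
          omega
    rw [norm_mul, norm_mul, norm_mul, Complex.norm_real, Complex.norm_real,
      Real.norm_of_nonneg (by positivity), Real.norm_eq_abs]
    calc _ ≤ jb2 x y ^ p * (‖A (x, t)‖ * ‖B (t, y)‖ *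
          (C₁ * (jb t ^ r * jb t ^ (-(n + 1 : ℝ))))) := by
          rw [← e]; gcongr; exact hμ t
      _ = C₁ * ((jb2 x y ^ p * jb t ^ r) * (‖A (x, t)‖ * ‖B (t, y)‖)) *
          jb t ^ (-(n + 1 : ℝ)) := by ring
      _ ≤ C₁ * ((jb2 x t ^ (2 * (p + r)) * jb2 t y ^ p) * (‖A (x, t)‖ * ‖B (t, y)‖)) *
          jb t ^ (-(n + 1 : ℝ)) := by gcongr
      _ = C₁ * (jb2 x t ^ (2 * (p + r)) * ‖A (x, t)‖) * (jb2 t y ^ p * ‖B (t, y)‖) *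
          jb t ^ (-(n + 1 : ℝ)) := by ring
      _ ≤ _ := by
        gcongr
        · exact ha x t
        · exact hb t y
  have := norm_integral_le_of_norm_le (aux_jb_int.const_mul (C₁ * a * b))
    (Filter.Eventually.of_forall key)
  rw [integral_const_mul, integral_const_mul, norm_mul, Complex.norm_real,
    Real.norm_of_nonneg (by positivity)] at this
  refine this.trans (le_of_eq ?_)
  ring

end kernels
end helpers

/-- The Volterra-type product
`(K·K')(x,y) = ∫ K(x,t) K'(t,y) μ(t) dt` of Schwartz kernels is Schwartz, with the
seminorm estimate `q_{p,(α,β)}(K·K') ≤ C q_{2(p+r),(α,0)}(K) q_{p,(0,β)}(K')`. -/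
theorem statement5 {n : ℕ} (hn : 0 < n) (r : ℕ) (C₁ : ℝ) (hC₁ : 0 < C₁)
    (μ : (Fin n → ℝ) → ℝ) (hμc : Continuous μ)
    (hμ : ∀ t, |μ t| ≤ C₁ * jb t ^ ((r : ℝ) - n - 1))
    (K K' : SchwartzMap ((Fin n → ℝ) × (Fin n → ℝ)) ℂ) :
    (∃ P : SchwartzMap ((Fin n → ℝ) × (Fin n → ℝ)) ℂ,
      ∀ x y, P (x, y) = ∫ t, K (x, t) * K' (t, y) * (μ t : ℂ)) ∧
    ∀ (p : ℕ) (α β : Fin n → ℕ),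
      qSem p α β (fun x y => ∫ t, K (x, t) * K' (t, y) * (μ t : ℂ)) ≤
        (C₁ * ∫ t : Fin n → ℝ, jb t ^ (-(n + 1 : ℝ))) *
          qSem (2 * (p + r)) α 0 (fun x y => K (x, y)) *
          qSem p 0 β (fun x y => K' (x, y)) := by
  have hμ' : ∀ t, |μ t| ≤ (C₁ * (2 * n + 1) ^ r) * (1 + ‖t‖) ^ r := by
    intro t
    have h1 := one_le_jb t
    calc |μ t| ≤ C₁ * jb t ^ ((r : ℝ) - n - 1) := hμ t
      _ ≤ C₁ * jb t ^ (r : ℝ) := by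
        gcongr
        linarith [(Nat.cast_nonneg n : (0 : ℝ) ≤ n)]
      _ = C₁ * jb t ^ r := by rw [Real.rpow_natCast]
      _ ≤ C₁ * ((2 * n + 1) * (1 + ‖t‖)) ^ r := by
        gcongr
        exact jb_le t
      _ = _ := by rw [mul_pow]; ring
  refine ⟨⟨auxP r _ μ hμc hμ' (auxG K K'), fun x y => (auxI_eq μ K K' (x, y)).symm⟩, ?_⟩
  intro p α β
  have hA : qSem (2 * (p + r)) α 0 (fun x y => K (x, y)) =
      ⨆ q : (Fin n → ℝ) × (Fin n → ℝ), jb2 q.1 q.2 ^ (2 * (p + r)) * ‖auxXm α K q‖ := by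
    unfold qSem
    simp only [aux_pdm2_X]
  have hB : qSem p 0 β (fun x y => K' (x, y)) =
      ⨆ q : (Fin n → ℝ) × (Fin n → ℝ), jb2 q.1 q.2 ^ p * ‖auxYm β K' q‖ := by
    unfold qSem
    simp only [aux_pdm2_Y]
  rw [hA, hB]
  refine ciSup_le fun q => ?_
  have e := aux_pdm2_I r _ μ hμc hμ' K K' α β q.1 q.2
  change jb2 q.1 q.2 ^ p * ‖pdm2 α β (auxI μ K K') q.1 q.2‖ ≤ _
  rw [e]
  exact aux_main r C₁ hC₁ μ hμ (auxXm α K) (auxYm β K') p _ _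
    (fun x t => le_ciSup (aux_bdd (2 * (p + r)) (auxXm α K)) (x, t))
    (fun t y => le_ciSup (aux_bdd p (auxYm β K')) (t, y)) q.1 q.2
end
end
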